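/- arXiv:1410.5998 — 2 statements merged into one kernel-verified Lean document; each statement's English description precedes it below -/
import Mathlib

section
/- Suppose the Hilbert triple H² ⊂ H¹ ⊂ H⁰ and the operator A satisfy hypothesis (HA). Then for every interval [a,b] and every ξ ∈ 𝒲¹([a,b]) whose traces ξ(a), ξ(b) lie in E^{1/2}, one has the identity ∫_a^b ‖∂_sξ + Aξ‖²_{H⁰} ds = ∫_a^b (‖∂_sξ‖²_{H⁰} + ‖Aξ‖²_{H⁰}) ds + q_A(ξ(b)) − q_A(ξ(a)), where q_A(ζ) := Σ_λ λ·|ζ_λ|² is the quadratic form of A evaluated on the eigenvector expansion ζ = Σ_λ ζ_λ e_λ. -/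
open scoped RealInnerProductSpace
open MeasureTheory

/-- The codomain of a compact operator with dense range is separable. -/
theorem separableSpace_of_isCompactOperator_of_denseRange {E F : Type*}
    [NormedAddCommGroup E] [NormedSpace ℝ E] [NormedAddCommGroup F] [NormedSpace ℝ F]
    (T : E →L[ℝ] F) (hT : IsCompactOperator (T : E → F)) (hd : DenseRange T) :
    TopologicalSpace.SeparableSpace F := by
  have hsep : TopologicalSpace.IsSeparable (Set.range T) := by
    have himage : ∀ n : ℕ,
        TopologicalSpace.IsSeparable (T '' Metric.closedBall (0 : E) n) := fun n => by
      obtain ⟨K, hK, hsub⟩ :=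
        IsCompactOperator.image_closedBall_subset_compact (f := T.toLinearMap) hT n
      exact hK.isSeparable.mono hsub
    refine (TopologicalSpace.IsSeparable.iUnion himage).mono ?_
    rintro _ ⟨x, rfl⟩
    obtain ⟨n, hn⟩ := exists_nat_ge ‖x‖
    exact Set.mem_iUnion.2 ⟨n, x, by simpa using hn, rfl⟩
  rw [← TopologicalSpace.isSeparable_univ_iff, ← hd.closure_range]
  exact hsep.closure

/-- An orthonormal family in a separable inner product space is countable. -/
theorem Orthonormal.countable_index {E ι : Type*} [NormedAddCommGroup E] [InnerProductSpace ℝ E]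
    [TopologicalSpace.SeparableSpace E] {e : ι → E} (he : Orthonormal ℝ e) : Countable ι := by
  refine Pairwise.countable_of_isOpen_disjoint (s := fun i => Metric.ball (e i) (1 / 2)) ?_
    (fun i => Metric.isOpen_ball) (fun i => ⟨e i, by simp⟩)
  intro i j hij
  refine Metric.ball_disjoint_ball ?_
  have h : ‖e i - e j‖ ^ 2 = 2 := by
    rw [norm_sub_sq_real, he.1 i, he.1 j, he.2 hij]
    norm_num
  rw [dist_eq_norm]
  nlinarith [norm_nonneg (e i - e j)]

/-- Suppose the Hilbert triple `H² ⊂ H¹ ⊂ H⁰` and the operator `A` satisfy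
hypothesis (HA); let `(e i)` be an orthonormal basis of `H⁰` of eigenvectors of `A` with
(nonzero) eigenvalues `μ i`.  Then for every interval `[a,b]` and every `ξ ∈ 𝒲¹([a,b])`
(a path `ξ : [a,b] → H¹` with derivative `ξ'` in `H⁰` and square-integrable `H¹`- resp.
`H⁰`-norms) whose traces `ξ(a), ξ(b)` lie in `E^{1/2}`, one has
`∫_a^b ‖∂_sξ + Aξ‖²_{H⁰} ds
   = ∫_a^b (‖∂_sξ‖²_{H⁰} + ‖Aξ‖²_{H⁰}) ds + q_A(ξ(b)) − q_A(ξ(a))`,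
where `q_A(ζ) = Σ_λ λ·|ζ_λ|²` is the quadratic form of `A` on the eigenvector expansion. -/
theorem stmt_1
    {H0 H1 H2 : Type*}
    [NormedAddCommGroup H0] [InnerProductSpace ℝ H0] [CompleteSpace H0]
    [NormedAddCommGroup H1] [InnerProductSpace ℝ H1] [CompleteSpace H1]
    [NormedAddCommGroup H2] [InnerProductSpace ℝ H2] [CompleteSpace H2]
    (i10 : H1 →L[ℝ] H0) (i21 : H2 →L[ℝ] H1)
    (hi10inj : Function.Injective i10) (hi21inj : Function.Injective i21)
    (hi10dense : DenseRange i10) (hi21dense : DenseRange i21)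
    (hi10cpt : IsCompactOperator (i10 : H1 → H0))
    (hi21cpt : IsCompactOperator (i21 : H2 → H1))
    (A : H1 →L[ℝ] H0)
    (hAbij : Function.Bijective A)
    (hAsym : ∀ x y : H1, ⟪A x, i10 y⟫ = ⟪i10 x, A y⟫)
    (A2 : H2 →L[ℝ] H1) (hA2 : ∀ ξ : H2, i10 (A2 ξ) = A (i21 ξ))
    (hdom : ∀ ξ : H1, (∃ η : H1, i10 η = A ξ) → ∃ ζ : H2, i21 ζ = ξ)
    -- the orthonormal basis of `H⁰` of eigenvectors of `A` with nonzero eigenvalues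
    {ι : Type*} (e : ι → H0) (μ : ι → ℝ)
    (hON : Orthonormal ℝ e)
    (hSpan : (Submodule.span ℝ (Set.range e)).topologicalClosure = ⊤)
    (e1 : ι → H1) (he1 : ∀ i, i10 (e1 i) = e i)
    (hAe : ∀ i, A (e1 i) = μ i • e i)
    (hμ : ∀ i, μ i ≠ 0)
    -- the interval `[a,b]` and `ξ ∈ 𝒲¹([a,b]) = L²([a,b],H¹) ∩ W^{1,2}([a,b],H⁰)`
    (a b : ℝ) (hab : a ≤ b)
    (ξ : ℝ → H1) (ξ' : ℝ → H0)
    (hderiv : ∀ s ∈ Set.Icc a b,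
      HasDerivWithinAt (fun s => i10 (ξ s)) (ξ' s) (Set.Icc a b) s)
    (hint1 : IntervalIntegrable (fun s => ‖ξ s‖ ^ 2) volume a b)
    (hint0 : IntervalIntegrable (fun s => ‖ξ' s‖ ^ 2) volume a b)
    -- the traces `ξ(a), ξ(b)` lie in `E^{1/2} = Dom(|A|^{1/2})`
    (htra : Summable fun i => |μ i| * ⟪i10 (ξ a), e i⟫ ^ 2)
    (htrb : Summable fun i => |μ i| * ⟪i10 (ξ b), e i⟫ ^ 2) :
    ∫ s in a..b, ‖ξ' s + A (ξ s)‖ ^ 2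
      = (∫ s in a..b, (‖ξ' s‖ ^ 2 + ‖A (ξ s)‖ ^ 2))
        + (∑' i, μ i * ⟪i10 (ξ b), e i⟫ ^ 2)
        - (∑' i, μ i * ⟪i10 (ξ a), e i⟫ ^ 2) := by
  have hsep := separableSpace_of_isCompactOperator_of_denseRange i10 hi10cpt hi10dense
  have hcount : Countable ι := hON.countable_index
  have hparseval : ∀ u v : H0, HasSum (fun i => ⟪u, e i⟫ * ⟪v, e i⟫) ⟪u, v⟫ := fun u v => by
    have h := (HilbertBasis.mk hON hSpan.ge).hasSum_inner_mul_inner u v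
    simpa [real_inner_comm] using h
  have hAcoeff : ∀ x i, ⟪A x, e i⟫ = μ i * ⟪i10 x, e i⟫ := fun x i => by
    rw [← he1 i, hAsym, hAe, inner_smul_right, he1]
  have hcoeffderiv : ∀ i, ∀ s ∈ Set.Icc a b,
      HasDerivWithinAt (fun s => ⟪i10 (ξ s), e i⟫) ⟪ξ' s, e i⟫ (Set.Icc a b) s :=
    fun i s hs => by
      simpa using (hderiv s hs).inner ℝ (hasDerivWithinAt_const s (Set.Icc a b) (e i))
  have hcoeffcont : ∀ i, ContinuousOn (fun s => ⟪i10 (ξ s), e i⟫) (Set.Icc a b) :=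
    fun i s hs => (hcoeffderiv i s hs).continuousWithinAt
  have hcoeffderivAt : ∀ i, ∀ s ∈ Set.Ioo a b,
      HasDerivAt (fun s => ⟪i10 (ξ s), e i⟫) ⟪ξ' s, e i⟫ s := fun i s hs =>
    (hcoeffderiv i s (Set.Ioo_subset_Icc_self hs)).hasDerivAt (Icc_mem_nhds hs.1 hs.2)
  have hmeasA : ∀ i, AEStronglyMeasurable (fun s => ⟪A (ξ s), e i⟫)
      (volume.restrict (Set.Ioc a b)) := fun i => by
    simp only [hAcoeff]
    exact ((hcoeffcont i).mono Set.Ioc_subset_Icc_self).aestronglyMeasurable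
      measurableSet_Ioc |>.const_mul _
  have hmeas' : ∀ i, AEStronglyMeasurable (fun s => ⟪ξ' s, e i⟫)
      (volume.restrict (Set.Ioc a b)) := fun i => by
    rw [← restrict_Ioo_eq_restrict_Ioc]
    refine (measurable_deriv (fun s => ⟪i10 (ξ s), e i⟫)).aestronglyMeasurable.congr ?_
    filter_upwards [ae_restrict_mem measurableSet_Ioo] with s hs
    exact (hcoeffderivAt i s hs).deriv
  have hmeasinner : ∀ u v : ℝ → H0,
      (∀ i, AEStronglyMeasurable (fun s => ⟪u s, e i⟫) (volume.restrict (Set.Ioc a b))) →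
      (∀ i, AEStronglyMeasurable (fun s => ⟪v s, e i⟫) (volume.restrict (Set.Ioc a b))) →
      AEStronglyMeasurable (fun s => ⟪u s, v s⟫) (volume.restrict (Set.Ioc a b)) :=
    fun u v hu hv => by
      refine aestronglyMeasurable_of_tendsto_ae (Filter.atTop : Filter (Finset ι))
        (f := fun S s => ∑ i ∈ S, ⟪u s, e i⟫ * ⟪v s, e i⟫) (fun S => ?_)
        (Filter.Eventually.of_forall fun s => hparseval (u s) (v s))
      exact Finset.aestronglyMeasurable_fun_sum S fun i _ => (hu i).mul (hv i)
  have hintA : IntervalIntegrable (fun s => ‖A (ξ s)‖ ^ 2) volume a b := by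
    refine (hint1.const_mul (‖A‖ ^ 2)).mono_fun ?_ (Filter.Eventually.of_forall fun s => ?_)
    · rw [Set.uIoc_of_le hab]
      simpa only [real_inner_self_eq_norm_sq] using
        hmeasinner (fun s => A (ξ s)) (fun s => A (ξ s)) hmeasA hmeasA
    · simp only [norm_mul, norm_pow, norm_norm, ← mul_pow]
      gcongr
      exact A.le_opNorm _
  have hintsum : IntervalIntegrable (fun s => ‖ξ' s‖ ^ 2 + ‖A (ξ s)‖ ^ 2) volume a b :=
    hint0.add hintA
  have hintinner : IntervalIntegrable (fun s => 2 * ⟪ξ' s, A (ξ s)⟫) volume a b := by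
    refine hintsum.mono_fun ?_ (Filter.Eventually.of_forall fun s => ?_)
    · rw [Set.uIoc_of_le hab]
      exact (hmeasinner ξ' (fun s => A (ξ s)) hmeas' hmeasA).const_mul 2
    · have h := abs_real_inner_le_norm (ξ' s) (A (ξ s))
      simp only [Real.norm_eq_abs]
      rw [abs_mul, abs_two, abs_of_nonneg (by positivity : 0 ≤ ‖ξ' s‖ ^ 2 + ‖A (ξ s)‖ ^ 2)]
      nlinarith [sq_nonneg (‖ξ' s‖ - ‖A (ξ s)‖)]
  have hmeasterm : ∀ i, AEStronglyMeasurable (fun s => 2 * (⟪ξ' s, e i⟫ * ⟪A (ξ s), e i⟫))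
      (volume.restrict (Set.uIoc a b)) := fun i => by
    rw [Set.uIoc_of_le hab]
    exact ((hmeas' i).mul (hmeasA i)).const_mul 2
  have hbound : ∀ i s, ‖2 * (⟪ξ' s, e i⟫ * ⟪A (ξ s), e i⟫)‖
      ≤ ⟪ξ' s, e i⟫ * ⟪ξ' s, e i⟫ + ⟪A (ξ s), e i⟫ * ⟪A (ξ s), e i⟫ := fun i s => by
    rw [Real.norm_eq_abs, abs_le]
    constructor
    · nlinarith [sq_nonneg (⟪ξ' s, e i⟫ + ⟪A (ξ s), e i⟫)]
    · nlinarith [sq_nonneg (⟪ξ' s, e i⟫ - ⟪A (ξ s), e i⟫)]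
  have hboundsum : ∀ s, HasSum
      (fun i => ⟪ξ' s, e i⟫ * ⟪ξ' s, e i⟫ + ⟪A (ξ s), e i⟫ * ⟪A (ξ s), e i⟫)
      (‖ξ' s‖ ^ 2 + ‖A (ξ s)‖ ^ 2) := fun s => by
    simpa only [real_inner_self_eq_norm_sq] using
      (hparseval (ξ' s) (ξ' s)).add (hparseval (A (ξ s)) (A (ξ s)))
  have hintterm : ∀ i, IntervalIntegrable (fun s => 2 * (⟪ξ' s, e i⟫ * ⟪A (ξ s), e i⟫))
      volume a b := fun i => by
    refine hintsum.mono_fun (hmeasterm i) (Filter.Eventually.of_forall fun s => ?_)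
    refine ((hbound i s).trans ?_).trans (le_abs_self _)
    exact le_hasSum (hboundsum s) i fun j _ =>
      add_nonneg (mul_self_nonneg _) (mul_self_nonneg _)
  have hterm : ∀ i, ∫ s in a..b, 2 * (⟪ξ' s, e i⟫ * ⟪A (ξ s), e i⟫)
      = μ i * ⟪i10 (ξ b), e i⟫ ^ 2 - μ i * ⟪i10 (ξ a), e i⟫ ^ 2 := fun i => by
    refine intervalIntegral.integral_eq_sub_of_hasDerivAt_of_le
      (f := fun s => μ i * ⟪i10 (ξ s), e i⟫ ^ 2) hab
      (((hcoeffcont i).pow 2).const_mul (μ i)) (fun s hs => ?_) (hintterm i)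
    refine (((hcoeffderivAt i s hs).pow 2).const_mul (μ i)).congr_deriv ?_
    rw [hAcoeff]
    push_cast
    ring
  have hsum : HasSum (fun i => ∫ s in a..b, 2 * (⟪ξ' s, e i⟫ * ⟪A (ξ s), e i⟫))
      (∫ s in a..b, 2 * ⟪ξ' s, A (ξ s)⟫) := by
    refine intervalIntegral.hasSum_integral_of_dominated_convergence
      (fun i s => ⟪ξ' s, e i⟫ * ⟪ξ' s, e i⟫ + ⟪A (ξ s), e i⟫ * ⟪A (ξ s), e i⟫)
      hmeasterm (fun i => Filter.Eventually.of_forall fun s _ => hbound i s)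
      (Filter.Eventually.of_forall fun s _ => (hboundsum s).summable) ?_
      (Filter.Eventually.of_forall fun s _ => (hparseval _ _).mul_left 2)
    simpa only [fun s => (hboundsum s).tsum_eq] using hintsum
  have hsummable : ∀ x : H1, (Summable fun i => |μ i| * ⟪i10 x, e i⟫ ^ 2) →
      Summable fun i => μ i * ⟪i10 x, e i⟫ ^ 2 := fun x hx =>
    Summable.of_norm (by simpa [abs_mul] using hx)
  have hcross : ∫ s in a..b, 2 * ⟪ξ' s, A (ξ s)⟫
      = (∑' i, μ i * ⟪i10 (ξ b), e i⟫ ^ 2) - ∑' i, μ i * ⟪i10 (ξ a), e i⟫ ^ 2 := by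
    simp only [hterm] at hsum
    exact hsum.unique ((hsummable _ htrb).hasSum.sub (hsummable _ htra).hasSum)
  rw [add_sub_assoc, ← hcross, ← intervalIntegral.integral_add hintsum hintinner]
  congr 1 with s
  rw [norm_add_sq_real]
  ring
end

section
/- Suppose the Hilbert triple H² ⊂ H¹ ⊂ H⁰ and the operator A satisfy hypothesis (HA), and let D_Aξ := ∂_sξ + Aξ. Then for i = 1 and i = 2 there exists a constant c_i > 0, independent of a and b, such that for every interval [a,b] and every ξ ∈ 𝒲^i([a,b]) the estimate ‖ξ‖_{𝒲^i([a,b])} ≤ c_i·( ‖D_Aξ‖_{𝒲^{i−1}([a,b])} + ‖π⁺(ξ(a))‖_{i−1/2} + ‖π⁻(ξ(b))‖_{i−1/2} ) holds. -/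
open scoped RealInnerProductSpace
open MeasureTheory

open TopologicalSpace Filter Set in
/-- An orthonormal family in a Hilbert space which is the closure of the range of a compact operator
is countable. -/
lemma Orthonormal.countable_of_isCompactOperator_denseRange
    {H K ι : Type*} [NormedAddCommGroup H] [InnerProductSpace ℝ H]
    [NormedAddCommGroup K] [NormedSpace ℝ K] {e : ι → H} (he : Orthonormal ℝ e)
    (T : K →L[ℝ] H) (hT : IsCompactOperator (T : K → H)) (hd : DenseRange T) :
    Countable ι := by
  have hsep : IsSeparable (range T) := by
    have hU : range T ⊆ ⋃ n : ℕ, T '' Metric.closedBall 0 n := by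
      rintro _ ⟨x, rfl⟩
      obtain ⟨n, hn⟩ := exists_nat_ge ‖x‖
      exact mem_iUnion.2 ⟨n, x, by simpa using hn, rfl⟩
    refine (IsSeparable.iUnion fun n : ℕ => ?_).mono hU
    obtain ⟨C, hC, hsub⟩ :=
      IsCompactOperator.image_closedBall_subset_compact (f := (T : K →ₗ[ℝ] H)) hT n
    exact hC.isSeparable.mono hsub
  have : SeparableSpace H := by
    rw [← isSeparable_univ_iff, ← hd.closure_range]
    exact hsep.closure
  refine Pairwise.countable_of_isOpen_disjoint (s := fun i => Metric.ball (e i) (1 / 2))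
    (fun i j hij => ?_) (fun _ => Metric.isOpen_ball)
    (fun i => ⟨e i, Metric.mem_ball_self (by norm_num)⟩)
  refine Metric.ball_disjoint_ball ?_
  have h := norm_sub_sq_real (e i) (e j)
  rw [he.2 hij, he.1 i, he.1 j, ← dist_eq_norm] at h
  nlinarith [dist_nonneg (x := e i) (y := e j)]

/-- A derivative along a compact interval is almost everywhere strongly measurable. -/
lemma aestronglyMeasurable_of_hasDerivWithinAt_Icc
    {E : Type*} [NormedAddCommGroup E] [NormedSpace ℝ E] [CompleteSpace E] {a b : ℝ}
    {u u' : ℝ → E} (h : ∀ s ∈ Set.Icc a b, HasDerivWithinAt u (u' s) (Set.Icc a b) s) :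
    AEStronglyMeasurable u' (volume.restrict (Set.Ioc a b)) := by
  rw [← Measure.restrict_congr_set (Ioo_ae_eq_Ioc (a := a) (b := b))]
  refine (aestronglyMeasurable_deriv u _).congr ?_
  refine ae_restrict_of_forall_mem measurableSet_Ioo fun s hs => ?_
  exact ((h s (Set.Ioo_subset_Icc_self hs)).hasDerivAt (Icc_mem_nhds hs.1 hs.2)).deriv

/-- A function into a Hilbert space with a countable Hilbert basis is almost everywhere strongly
measurable once its coordinates are. -/
lemma HilbertBasis.aestronglyMeasurable_of_inner
    {α ι H : Type*} [MeasurableSpace α] {ν : Measure α} [Countable ι]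
    [NormedAddCommGroup H] [InnerProductSpace ℝ H] [CompleteSpace H]
    (e : HilbertBasis ι ℝ H) {f : α → H}
    (h : ∀ i, AEStronglyMeasurable (fun s => ⟪f s, e i⟫) ν) : AEStronglyMeasurable f ν := by
  refine aestronglyMeasurable_of_tendsto_ae (Filter.atTop : Filter (Finset ι))
    (f := fun F s => ∑ i ∈ F, ⟪f s, e i⟫ • e i) (fun F => ?_) (ae_of_all _ fun s => ?_)
  · exact Finset.aestronglyMeasurable_fun_sum F fun i _ => (h i).smul_const (e i)
  · have := e.hasSum_repr (f s)
    simpa only [HasSum, e.repr_apply_apply, real_inner_comm,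
      SummationFilter.unconditional_filter] using this

/-- Parseval's identity over the reals. -/
lemma HilbertBasis.hasSum_sq_inner {ι H : Type*}
    [NormedAddCommGroup H] [InnerProductSpace ℝ H] [CompleteSpace H]
    (e : HilbertBasis ι ℝ H) (x : H) : HasSum (fun i => ⟪x, e i⟫ ^ 2) (‖x‖ ^ 2) := by
  rw [← real_inner_self_eq_norm_sq]
  convert! e.hasSum_inner_mul_inner x x using 2 with i
  rw [real_inner_comm x (e i), sq]

lemma intervalIntegrable_of_sq {a b : ℝ} (hab : a ≤ b) {x : ℝ → ℝ}
    (hm : AEStronglyMeasurable x (volume.restrict (Set.Ioc a b)))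
    (hx : IntervalIntegrable (fun s => x s ^ 2) volume a b) : IntervalIntegrable x volume a b := by
  rw [intervalIntegrable_iff_integrableOn_Ioc_of_le hab] at hx ⊢
  refine Integrable.mono' (hx.add (integrable_const (1 : ℝ))) hm (ae_of_all _ fun s => ?_)
  rw [Real.norm_eq_abs, Pi.add_apply]
  nlinarith [sq_abs (x s), sq_nonneg (|x s| - 1)]

lemma intervalIntegrable_mono_norm {E : Type*} [NormedAddCommGroup E] {a b : ℝ} (hab : a ≤ b)
    {f : ℝ → E} {g : ℝ → ℝ}
    (hm : AEStronglyMeasurable f (volume.restrict (Set.Ioc a b)))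
    (hg : IntervalIntegrable g volume a b) (h : ∀ s, ‖f s‖ ≤ g s) :
    IntervalIntegrable f volume a b := by
  rw [intervalIntegrable_iff_integrableOn_Ioc_of_le hab] at hg ⊢
  exact Integrable.mono' hg hm (ae_of_all _ h)

/-- The energy identity for the scalar operator `x ↦ x' + m x`. -/
lemma integral_sq_add_sq_eq_of_hasDerivWithinAt {a b : ℝ} (hab : a ≤ b) (m : ℝ) {x x' : ℝ → ℝ}
    (hx : ∀ s ∈ Set.Icc a b, HasDerivWithinAt x (x' s) (Set.Icc a b) s)
    (hx' : IntervalIntegrable (fun s => x' s ^ 2) volume a b) :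
    ∫ s in a..b, ((m * x s) ^ 2 + x' s ^ 2)
      = (∫ s in a..b, (x' s + m * x s) ^ 2) + (m * x a ^ 2 - m * x b ^ 2) := by
  have hm := aestronglyMeasurable_of_hasDerivWithinAt_Icc hx
  have hc : ContinuousOn x (Set.Icc a b) := fun s hs => (hx s hs).continuousWithinAt
  have hc' : ContinuousOn x (Set.uIcc a b) := by rwa [Set.uIcc_of_le hab]
  have hi : IntervalIntegrable (fun s => x s * x' s) volume a b :=
    (intervalIntegrable_of_sq hab hm hx').continuousOn_mul hc'
  have hi2 : IntervalIntegrable (fun s => m * (2 * (x s * x' s))) volume a b :=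
    (hi.const_mul 2).const_mul m
  have hi3 : IntervalIntegrable (fun s => (m * x s) ^ 2 + x' s ^ 2) volume a b :=
    ((continuousOn_const.mul hc').pow 2).intervalIntegrable.add hx'
  have hftc : ∫ s in a..b, m * (2 * (x s * x' s)) = m * x b ^ 2 - m * x a ^ 2 := by
    refine intervalIntegral.integral_eq_sub_of_hasDerivAt_of_le (f := fun s => m * x s ^ 2) hab
      (continuousOn_const.mul (hc.pow 2)) (fun s hs => ?_) hi2
    have h := (hx s (Set.Ioo_subset_Icc_self hs)).hasDerivAt (Icc_mem_nhds hs.1 hs.2)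
    convert! (h.pow 2).const_mul m using 1
    push_cast
    ring
  have hsum : ∫ s in a..b, (x' s + m * x s) ^ 2
      = (∫ s in a..b, ((m * x s) ^ 2 + x' s ^ 2)) + ∫ s in a..b, m * (2 * (x s * x' s)) := by
    rw [← intervalIntegral.integral_add hi3 hi2]
    congr 1
    ext s
    ring
  rw [hsum, hftc]
  ring

open Filter in
/-- The energy estimate for `u' + v`, where `v = A u` in the sense of a diagonal operator `A` with
eigenvalues `m i` in the Hilbert basis `e`. -/
lemma HilbertBasis.energy_estimate
    {ι H : Type*} [Countable ι]
    [NormedAddCommGroup H] [InnerProductSpace ℝ H] [CompleteSpace H]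
    (e : HilbertBasis ι ℝ H) (m : ι → ℝ) {a b : ℝ} (hab : a ≤ b) {u u' v : ℝ → H}
    (hu : ∀ s ∈ Set.Icc a b, HasDerivWithinAt u (u' s) (Set.Icc a b) s)
    (hv : ∀ s i, ⟪v s, e i⟫ = m i * ⟪u s, e i⟫)
    (hvi : IntervalIntegrable (fun s => ‖v s‖ ^ 2) volume a b)
    (hui : IntervalIntegrable (fun s => ‖u' s‖ ^ 2) volume a b)
    (hfi : IntervalIntegrable (fun s => ‖u' s + v s‖ ^ 2) volume a b)
    (hsa : Summable fun i => if 0 < m i then |m i| * ⟪u a, e i⟫ ^ 2 else 0)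
    (hsb : Summable fun i => if m i < 0 then |m i| * ⟪u b, e i⟫ ^ 2 else 0) :
    (∫ s in a..b, ‖v s‖ ^ 2) + (∫ s in a..b, ‖u' s‖ ^ 2)
      ≤ (∫ s in a..b, ‖u' s + v s‖ ^ 2)
        + (∑' i, if 0 < m i then |m i| * ⟪u a, e i⟫ ^ 2 else 0)
        + (∑' i, if m i < 0 then |m i| * ⟪u b, e i⟫ ^ 2 else 0) := by
  have hxd : ∀ i, ∀ s ∈ Set.Icc a b,
      HasDerivWithinAt (fun s => ⟪u s, e i⟫) ⟪u' s, e i⟫ (Set.Icc a b) s := fun i s hs => by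
    simpa using (hu s hs).inner ℝ (hasDerivWithinAt_const s (Set.Icc a b) (e i))
  have hm' : AEStronglyMeasurable u' (volume.restrict (Set.Ioc a b)) :=
    aestronglyMeasurable_of_hasDerivWithinAt_Icc hu
  have hmu' : ∀ i, AEStronglyMeasurable (fun s => ⟪u' s, e i⟫)
      (volume.restrict (Set.Ioc a b)) := fun i => hm'.inner aestronglyMeasurable_const
  have hmu : ∀ i, AEStronglyMeasurable (fun s => ⟪u s, e i⟫)
      (volume.restrict (Set.Ioc a b)) := fun i =>
    (ContinuousOn.mono (fun s hs => (hxd i s hs).continuousWithinAt)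
      Set.Ioc_subset_Icc_self).aestronglyMeasurable measurableSet_Ioc
  have bessel : ∀ (x : H) i, ⟪x, e i⟫ ^ 2 ≤ ‖x‖ ^ 2 := fun x i =>
    le_hasSum (e.hasSum_sq_inner x) i fun j _ => sq_nonneg _
  have hxi : ∀ i, IntervalIntegrable (fun s => ⟪u' s, e i⟫ ^ 2) volume a b := fun i =>
    intervalIntegrable_mono_norm hab ((hmu' i).pow 2) hui fun s => by
      rw [Real.norm_of_nonneg (sq_nonneg _)]
      exact bessel _ _
  have hvxi : ∀ i, IntervalIntegrable (fun s => (m i * ⟪u s, e i⟫) ^ 2) volume a b := fun i =>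
    intervalIntegrable_mono_norm hab (((hmu i).const_mul (m i)).pow 2) hvi fun s => by
      rw [Real.norm_of_nonneg (sq_nonneg _), ← hv]
      exact bessel _ _
  have hfxi : ∀ i, IntervalIntegrable (fun s => (⟪u' s, e i⟫ + m i * ⟪u s, e i⟫) ^ 2)
      volume a b := fun i =>
    intervalIntegrable_mono_norm hab (((hmu' i).add ((hmu i).const_mul (m i))).pow 2) hfi
      fun s => by
        rw [Real.norm_of_nonneg (sq_nonneg _), ← hv, ← inner_add_left]
        exact bessel _ _
  have hparseval : ∀ s, HasSum (fun i => (m i * ⟪u s, e i⟫) ^ 2 + ⟪u' s, e i⟫ ^ 2)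
      (‖v s‖ ^ 2 + ‖u' s‖ ^ 2) := fun s => by
    simp_rw [← hv]
    exact (e.hasSum_sq_inner (v s)).add (e.hasSum_sq_inner (u' s))
  have hlim : Tendsto (fun F : Finset ι => ∫ s in a..b,
      ∑ i ∈ F, ((m i * ⟪u s, e i⟫) ^ 2 + ⟪u' s, e i⟫ ^ 2)) atTop
      (nhds (∫ s in a..b, (‖v s‖ ^ 2 + ‖u' s‖ ^ 2))) := by
    refine intervalIntegral.tendsto_integral_filter_of_dominated_convergence
      (fun s => ‖v s‖ ^ 2 + ‖u' s‖ ^ 2) (Eventually.of_forall fun F => ?_)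
      (Eventually.of_forall fun F => ae_of_all _ fun s _ => ?_) (hvi.add hui)
      (ae_of_all _ fun s _ => hparseval s)
    · rw [Set.uIoc_of_le hab]
      exact Finset.aestronglyMeasurable_fun_sum F fun i _ =>
        (((hmu i).const_mul (m i)).pow 2).add ((hmu' i).pow 2)
    · rw [Real.norm_of_nonneg (Finset.sum_nonneg fun i _ => by positivity)]
      exact sum_le_hasSum F (fun i _ => by positivity) (hparseval s)
  rw [← intervalIntegral.integral_add hvi hui]
  refine le_of_tendsto' hlim fun F => ?_
  rw [intervalIntegral.integral_finsetSum fun i _ => (hvxi i).add (hxi i)]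
  have hmode : ∀ i ∈ F, ∫ s in a..b, ((m i * ⟪u s, e i⟫) ^ 2 + ⟪u' s, e i⟫ ^ 2)
      ≤ (∫ s in a..b, (⟪u' s, e i⟫ + m i * ⟪u s, e i⟫) ^ 2)
        + (if 0 < m i then |m i| * ⟪u a, e i⟫ ^ 2 else 0)
        + (if m i < 0 then |m i| * ⟪u b, e i⟫ ^ 2 else 0) := fun i _ => by
    rw [integral_sq_add_sq_eq_of_hasDerivWithinAt hab (m i) (hxd i) (hxi i), add_assoc]
    gcongr
    have ha := sq_nonneg ⟪u a, e i⟫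
    have hb := sq_nonneg ⟪u b, e i⟫
    rcases lt_trichotomy (m i) 0 with h | h | h
    · rw [if_neg h.not_gt, if_pos h, abs_of_neg h]
      nlinarith
    · simp [h]
    · rw [if_pos h, if_neg h.not_gt, abs_of_pos h]
      nlinarith
  refine (Finset.sum_le_sum hmode).trans ?_
  rw [Finset.sum_add_distrib, Finset.sum_add_distrib]
  gcongr
  · rw [← intervalIntegral.integral_finsetSum fun i _ => hfxi i]
    refine intervalIntegral.integral_mono_on hab
      (by simpa only [Finset.sum_fn] using IntervalIntegrable.sum F fun i _ => hfxi i) hfi fun s _ => ?_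
    simp_rw [← hv, ← inner_add_left]
    exact sum_le_hasSum F (fun i _ => sq_nonneg _) (e.hasSum_sq_inner _)
  · exact hsa.sum_le_tsum F fun i _ => by split_ifs <;> positivity
  · exact hsb.sum_le_tsum F fun i _ => by split_ifs <;> positivity

lemma sqrt_le_mul_add_sqrt {P M x y z : ℝ} (hM : 0 ≤ M) (hx : 0 ≤ x) (hy : 0 ≤ y)
    (hz : 0 ≤ z) (h : P ≤ M * (x + y + z)) :
    Real.sqrt P ≤ Real.sqrt M * (Real.sqrt x + Real.sqrt y + Real.sqrt z) := by
  refine (Real.sqrt_le_sqrt h).trans ?_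
  rw [Real.sqrt_mul hM]
  refine mul_le_mul_of_nonneg_left (Real.sqrt_le_iff.2 ⟨by positivity, ?_⟩) (Real.sqrt_nonneg _)
  nlinarith [Real.sq_sqrt hx, Real.sq_sqrt hy, Real.sq_sqrt hz, Real.sqrt_nonneg x,
    Real.sqrt_nonneg y, Real.sqrt_nonneg z, mul_nonneg (Real.sqrt_nonneg x) (Real.sqrt_nonneg y),
    mul_nonneg (Real.sqrt_nonneg x) (Real.sqrt_nonneg z),
    mul_nonneg (Real.sqrt_nonneg y) (Real.sqrt_nonneg z)]

/-- The bounded inverse theorem. -/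
lemma ContinuousLinearMap.exists_continuous_leftInverse_bound {E F : Type*}
    [NormedAddCommGroup E] [NormedSpace ℝ E] [CompleteSpace E]
    [NormedAddCommGroup F] [NormedSpace ℝ F] [CompleteSpace F]
    (T : E →L[ℝ] F) (hT : Function.Bijective T) :
    ∃ (S : F →L[ℝ] E) (K : ℝ), 0 ≤ K ∧ (∀ x, S (T x) = x) ∧ ∀ x, ‖x‖ ≤ K * ‖T x‖ := by
  let L := ContinuousLinearEquiv.ofBijective T (LinearMap.ker_eq_bot.2 hT.1)
    (LinearMap.range_eq_top.2 hT.2)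
  have hL : ∀ x, L.symm (T x) = x := L.symm_apply_apply
  refine ⟨L.symm, ‖(L.symm : F →L[ℝ] E)‖, norm_nonneg _, hL, fun x => ?_⟩
  have := (L.symm : F →L[ℝ] E).le_opNorm (T x)
  rwa [ContinuousLinearEquiv.coe_coe, hL] at this

/-- Under hypothesis (HA) for the Hilbert triple `H² ⊂ H¹ ⊂ H⁰`, with
`D_Aξ = ∂_sξ + Aξ`: for `i = 1` and `i = 2` there is a constant `c_i > 0`, independent of the
interval `[a,b]`, such that every `ξ ∈ 𝒲^i([a,b])` satisfies
`‖ξ‖_{𝒲^i} ≤ c_i (‖D_Aξ‖_{𝒲^{i-1}} + ‖π⁺(ξ(a))‖_{i-1/2} + ‖π⁻(ξ(b))‖_{i-1/2})`.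
Here `π^±` are the spectral projections onto positive/negative modes and `‖·‖_s` the
`Dom(|A|^s)`-norms, expressed through the eigenvector expansion. -/
theorem stmt_2
    {H0 H1 H2 : Type*}
    [NormedAddCommGroup H0] [InnerProductSpace ℝ H0] [CompleteSpace H0]
    [NormedAddCommGroup H1] [InnerProductSpace ℝ H1] [CompleteSpace H1]
    [NormedAddCommGroup H2] [InnerProductSpace ℝ H2] [CompleteSpace H2]
    (i10 : H1 →L[ℝ] H0) (i21 : H2 →L[ℝ] H1)
    (hi10inj : Function.Injective i10) (hi21inj : Function.Injective i21)
    (hi10dense : DenseRange i10) (hi21dense : DenseRange i21)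
    (hi10cpt : IsCompactOperator (i10 : H1 → H0))
    (hi21cpt : IsCompactOperator (i21 : H2 → H1))
    (A : H1 →L[ℝ] H0)
    (hAbij : Function.Bijective A)
    (hAsym : ∀ x y : H1, ⟪A x, i10 y⟫ = ⟪i10 x, A y⟫)
    (A2 : H2 →L[ℝ] H1) (hA2 : ∀ ξ : H2, i10 (A2 ξ) = A (i21 ξ))
    (hdom : ∀ ξ : H1, (∃ η : H1, i10 η = A ξ) → ∃ ζ : H2, i21 ζ = ξ)
    -- the orthonormal basis of `H⁰` of eigenvectors of `A` with nonzero eigenvalues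
    {ι : Type*} (e : ι → H0) (μ : ι → ℝ)
    (hON : Orthonormal ℝ e)
    (hSpan : (Submodule.span ℝ (Set.range e)).topologicalClosure = ⊤)
    (e1 : ι → H1) (he1 : ∀ i, i10 (e1 i) = e i)
    (hAe : ∀ i, A (e1 i) = μ i • e i)
    (hμ : ∀ i, μ i ≠ 0) :
    -- the case `i = 1`
    (∃ c1 : ℝ, 0 < c1 ∧ ∀ a b : ℝ, a ≤ b →
      ∀ (ξ : ℝ → H1) (ξ' : ℝ → H0),
        (∀ s ∈ Set.Icc a b,
          HasDerivWithinAt (fun s => i10 (ξ s)) (ξ' s) (Set.Icc a b) s) →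
        IntervalIntegrable (fun s => ‖ξ s‖ ^ 2) volume a b →
        IntervalIntegrable (fun s => ‖ξ' s‖ ^ 2) volume a b →
        Real.sqrt ((∫ s in a..b, ‖ξ s‖ ^ 2) + ∫ s in a..b, ‖ξ' s‖ ^ 2)
          ≤ c1 * (Real.sqrt (∫ s in a..b, ‖ξ' s + A (ξ s)‖ ^ 2)
              + Real.sqrt (∑' i, if 0 < μ i then |μ i| * ⟪i10 (ξ a), e i⟫ ^ 2 else 0)
              + Real.sqrt (∑' i, if μ i < 0 then |μ i| * ⟪i10 (ξ b), e i⟫ ^ 2 else 0)))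
    ∧
    -- the case `i = 2`
    (∃ c2 : ℝ, 0 < c2 ∧ ∀ a b : ℝ, a ≤ b →
      ∀ (ξ : ℝ → H2) (ξ' : ℝ → H1) (ξ'' : ℝ → H0),
        (∀ s ∈ Set.Icc a b,
          HasDerivWithinAt (fun s => i21 (ξ s)) (ξ' s) (Set.Icc a b) s) →
        (∀ s ∈ Set.Icc a b,
          HasDerivWithinAt (fun s => i10 (ξ' s)) (ξ'' s) (Set.Icc a b) s) →
        IntervalIntegrable (fun s => ‖ξ s‖ ^ 2) volume a b →
        IntervalIntegrable (fun s => ‖ξ' s‖ ^ 2) volume a b →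
        IntervalIntegrable (fun s => ‖ξ'' s‖ ^ 2) volume a b →
        Real.sqrt ((∫ s in a..b, ‖ξ s‖ ^ 2) + (∫ s in a..b, ‖ξ' s‖ ^ 2)
              + ∫ s in a..b, ‖ξ'' s‖ ^ 2)
          ≤ c2 * (Real.sqrt ((∫ s in a..b, ‖ξ' s + A2 (ξ s)‖ ^ 2)
                + ∫ s in a..b, ‖ξ'' s + A (ξ' s)‖ ^ 2)
              + Real.sqrt (∑' i, if 0 < μ i then |μ i| ^ 3 * ⟪i10 (i21 (ξ a)), e i⟫ ^ 2 else 0)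
              + Real.sqrt (∑' i, if μ i < 0 then |μ i| ^ 3 * ⟪i10 (i21 (ξ b)), e i⟫ ^ 2 else 0))) := by
  have : Countable ι := hON.countable_of_isCompactOperator_denseRange i10 hi10cpt hi10dense
  obtain ⟨S, K, hK, hSA, hKA⟩ := A.exists_continuous_leftInverse_bound hAbij
  have hA2bij : Function.Bijective A2 := by
    refine ⟨fun x y hxy => hi21inj (hAbij.1 ?_), fun η => ?_⟩
    · rw [← hA2, ← hA2, hxy]
    · obtain ⟨x, hx⟩ := hAbij.2 (i10 η)
      obtain ⟨ζ, hζ⟩ := hdom x ⟨η, hx.symm⟩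
      exact ⟨ζ, hi10inj (by rw [hA2, hζ, hx])⟩
  obtain ⟨-, K2, hK2, -, hKA2⟩ := A2.exists_continuous_leftInverse_bound hA2bij
  let B : HilbertBasis ι ℝ H0 := HilbertBasis.mk hON hSpan.ge
  have hB : ∀ i, B i = e i := fun i => congrFun (HilbertBasis.coe_mk hON hSpan.ge) i
  have hdiag : ∀ (x : H1) i, ⟪A x, e i⟫ = μ i * ⟪i10 x, e i⟫ := fun x i => by
    rw [← he1, hAsym, hAe, inner_smul_right, he1]
  have hsum : ∀ x : H1, Summable fun i => |μ i| * ⟪i10 x, e i⟫ ^ 2 := fun x => by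
    have h1 : Summable fun i => ⟪A x, e i⟫ ^ 2 := by
      simpa only [hB] using (B.hasSum_sq_inner (A x)).summable
    have h0 : Summable fun i => ⟪i10 x, e i⟫ ^ 2 := by
      simpa only [hB] using (B.hasSum_sq_inner (i10 x)).summable
    refine Summable.of_nonneg_of_le (fun i => by positivity) (fun i => ?_) (h1.add h0)
    rw [hdiag, mul_pow, ← sq_abs (μ i)]
    nlinarith [sq_nonneg ⟪i10 x, e i⟫,
      mul_nonneg (sq_nonneg (|μ i| - 1)) (sq_nonneg ⟪i10 x, e i⟫)]
  have hsum_ite : ∀ (x : H1) (p : ι → Prop) [DecidablePred p],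
      Summable fun i => if p i then |μ i| * ⟪i10 x, e i⟫ ^ 2 else 0 := fun x p _ =>
    Summable.of_nonneg_of_le (fun i => by split_ifs <;> positivity)
      (fun i => by split_ifs <;> first | exact le_rfl | positivity) (hsum x)
  have hsq : ∀ x : H1, ‖x‖ ^ 2 ≤ K ^ 2 * ‖A x‖ ^ 2 := fun x => by
    rw [← mul_pow]
    exact pow_le_pow_left₀ (norm_nonneg _) (hKA x) 2
  have hAsq : ∀ x : H1, ‖A x‖ ^ 2 ≤ ‖A‖ ^ 2 * ‖x‖ ^ 2 := fun x => by
    rw [← mul_pow]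
    exact pow_le_pow_left₀ (norm_nonneg _) (A.le_opNorm x) 2
  have hA2sq : ∀ x : H2, ‖A2 x‖ ^ 2 ≤ ‖A2‖ ^ 2 * ‖x‖ ^ 2 := fun x => by
    rw [← mul_pow]
    exact pow_le_pow_left₀ (norm_nonneg _) (A2.le_opNorm x) 2
  have hsq2 : ∀ x : H2, ‖x‖ ^ 2 ≤ K2 ^ 2 * ‖A2 x‖ ^ 2 := fun x => by
    rw [← mul_pow]
    exact pow_le_pow_left₀ (norm_nonneg _) (hKA2 x) 2
  have hpar : ∀ {E : Type _} [NormedAddCommGroup E] [InnerProductSpace ℝ E] (x y : E),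
      ‖x + y‖ ^ 2 ≤ 2 * (‖x‖ ^ 2 + ‖y‖ ^ 2) := fun x y =>
    (pow_le_pow_left₀ (norm_nonneg _) (norm_add_le x y) 2).trans add_sq_le
  have hmeas : ∀ {a b : ℝ} {u : ℝ → H1} {u' : ℝ → H0},
      (∀ s ∈ Set.Icc a b, HasDerivWithinAt (fun s => i10 (u s)) (u' s) (Set.Icc a b) s) →
      AEStronglyMeasurable (fun s => A (u s)) (volume.restrict (Set.Ioc a b)) := by
    intro a b u u' hu
    refine B.aestronglyMeasurable_of_inner fun i => ?_
    simp only [hB, hdiag]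
    have hc : ContinuousOn (fun s => μ i * ⟪i10 (u s), e i⟫) (Set.Icc a b) :=
      continuousOn_const.mul
        (ContinuousOn.inner (fun s hs => (hu s hs).continuousWithinAt) continuousOn_const)
    exact (hc.mono Set.Ioc_subset_Icc_self).aestronglyMeasurable measurableSet_Ioc
  have henergy : ∀ {a b : ℝ}, a ≤ b → ∀ {u : ℝ → H1} {u' : ℝ → H0} {g : ℝ → ℝ},
      (∀ s ∈ Set.Icc a b, HasDerivWithinAt (fun s => i10 (u s)) (u' s) (Set.Icc a b) s) →
      IntervalIntegrable g volume a b → (∀ s, ‖A (u s)‖ ^ 2 ≤ g s) →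
      IntervalIntegrable (fun s => ‖u' s‖ ^ 2) volume a b →
      IntervalIntegrable (fun s => ‖A (u s)‖ ^ 2) volume a b ∧
      IntervalIntegrable (fun s => ‖u' s + A (u s)‖ ^ 2) volume a b ∧
      (∫ s in a..b, ‖A (u s)‖ ^ 2) + (∫ s in a..b, ‖u' s‖ ^ 2)
      ≤ (∫ s in a..b, ‖u' s + A (u s)‖ ^ 2)
        + (∑' i, if 0 < μ i then |μ i| * ⟪i10 (u a), e i⟫ ^ 2 else 0)
        + (∑' i, if μ i < 0 then |μ i| * ⟪i10 (u b), e i⟫ ^ 2 else 0) := by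
    intro a b hab u u' g hu hg hgu hu'
    have hAi : IntervalIntegrable (fun s => ‖A (u s)‖ ^ 2) volume a b :=
      intervalIntegrable_mono_norm hab ((hmeas hu).norm.pow 2) hg fun s => by
        rw [Real.norm_of_nonneg (sq_nonneg _)]
        exact hgu s
    have hfi : IntervalIntegrable (fun s => ‖u' s + A (u s)‖ ^ 2) volume a b :=
      intervalIntegrable_mono_norm hab
        (((aestronglyMeasurable_of_hasDerivWithinAt_Icc hu).add (hmeas hu)).norm.pow 2)
        ((hu'.add hAi).const_mul 2) fun s => by
          rw [Real.norm_of_nonneg (sq_nonneg _)]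
          exact hpar _ _
    refine ⟨hAi, hfi, ?_⟩
    have := B.energy_estimate μ hab hu (v := fun s => A (u s))
      (fun s i => by rw [hB, hdiag]) hAi hu' hfi
      (by simpa only [hB] using hsum_ite (u a) fun i => 0 < μ i)
      (by simpa only [hB] using hsum_ite (u b) fun i => μ i < 0)
    simpa only [hB] using this
  have hbdry : ∀ (k : ℕ) (x : H0) (p : ι → Prop) [DecidablePred p],
      0 ≤ ∑' i, if p i then |μ i| ^ k * ⟪x, e i⟫ ^ 2 else 0 := fun k x p _ =>
    tsum_nonneg fun i => by split_ifs <;> positivity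
  refine ⟨⟨Real.sqrt (K ^ 2 + 1), by positivity, fun a b hab ξ ξ' hξ hi hi' => ?_⟩,
    ⟨Real.sqrt ((K2 ^ 2 * K ^ 2 + K ^ 2 + 2) * (‖A‖ ^ 2 + 1) + 2), by positivity,
      fun a b hab ξ ξ' ξ'' hξ hξ' hi hi' hi'' => ?_⟩⟩
  · obtain ⟨hAi, hfi, hE⟩ :=
      henergy hab hξ (hi.const_mul (‖A‖ ^ 2)) (fun s => hAsq (ξ s)) hi'
    have hx : ∫ s in a..b, ‖ξ s‖ ^ 2 ≤ K ^ 2 * ∫ s in a..b, ‖A (ξ s)‖ ^ 2 := by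
      rw [← intervalIntegral.integral_const_mul]
      exact intervalIntegral.integral_mono_on hab hi (hAi.const_mul _) fun s _ => hsq (ξ s)
    have h1 : 0 ≤ ∫ s in a..b, ‖A (ξ s)‖ ^ 2 :=
      intervalIntegral.integral_nonneg hab fun s _ => sq_nonneg _
    have h2 : 0 ≤ ∫ s in a..b, ‖ξ' s‖ ^ 2 :=
      intervalIntegral.integral_nonneg hab fun s _ => sq_nonneg _
    refine sqrt_le_mul_add_sqrt (by positivity)
      (intervalIntegral.integral_nonneg hab fun s _ => sq_nonneg _)
      (by simpa only [pow_one] using hbdry 1 _ fun i => 0 < μ i)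
      (by simpa only [pow_one] using hbdry 1 _ fun i => μ i < 0) ?_
    refine le_trans ?_ (mul_le_mul_of_nonneg_left hE (by positivity))
    nlinarith [mul_nonneg (sq_nonneg K) h2]
  · have hη : ∀ s ∈ Set.Icc a b,
        HasDerivWithinAt (fun s => i10 (A2 (ξ s))) (A (ξ' s)) (Set.Icc a b) s := fun s hs => by
      simp only [hA2]
      exact A.hasFDerivAt.comp_hasDerivWithinAt s (hξ s hs)
    have hm' : AEStronglyMeasurable ξ' (volume.restrict (Set.Ioc a b)) :=
      aestronglyMeasurable_of_hasDerivWithinAt_Icc hξ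
    have hAξ' : IntervalIntegrable (fun s => ‖A (ξ' s)‖ ^ 2) volume a b :=
      intervalIntegrable_mono_norm hab
        ((A.continuous.comp_aestronglyMeasurable hm').norm.pow 2)
        (hi'.const_mul (‖A‖ ^ 2)) fun s => by
          rw [Real.norm_of_nonneg (sq_nonneg _)]
          exact hAsq _
    obtain ⟨hAi, hfi, hE⟩ := henergy hab hη (hi.const_mul (‖A‖ ^ 2 * ‖A2‖ ^ 2))
      (fun s => (hAsq _).trans (by
        rw [mul_assoc]
        exact mul_le_mul_of_nonneg_left (hA2sq _) (sq_nonneg _))) hAξ'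
    have hmA2 : AEStronglyMeasurable (fun s => A2 (ξ s)) (volume.restrict (Set.Ioc a b)) := by
      simpa only [Function.comp_def, hSA] using S.continuous.comp_aestronglyMeasurable (hmeas hη)
    have hf : IntervalIntegrable (fun s => ‖ξ' s + A2 (ξ s)‖ ^ 2) volume a b :=
      intervalIntegrable_mono_norm hab ((hm'.add hmA2).norm.pow 2) (hfi.const_mul (K ^ 2))
        fun s => by
          rw [Real.norm_of_nonneg (sq_nonneg _), ← map_add]
          exact hsq _
    have hf' : IntervalIntegrable (fun s => ‖ξ'' s + A (ξ' s)‖ ^ 2) volume a b :=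
      intervalIntegrable_mono_norm hab
        (((aestronglyMeasurable_of_hasDerivWithinAt_Icc hξ').add
          (A.continuous.comp_aestronglyMeasurable hm')).norm.pow 2)
        ((hi''.add hAξ').const_mul 2) fun s => by
          rw [Real.norm_of_nonneg (sq_nonneg _)]
          exact hpar _ _
    have hx : ∫ s in a..b, ‖ξ s‖ ^ 2
        ≤ K2 ^ 2 * K ^ 2 * ∫ s in a..b, ‖A (A2 (ξ s))‖ ^ 2 := by
      rw [← intervalIntegral.integral_const_mul]
      refine intervalIntegral.integral_mono_on hab hi (hAi.const_mul _) fun s _ => ?_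
      rw [mul_assoc]
      exact (hsq2 _).trans (mul_le_mul_of_nonneg_left (hsq _) (sq_nonneg _))
    have hx' : ∫ s in a..b, ‖ξ' s‖ ^ 2 ≤ K ^ 2 * ∫ s in a..b, ‖A (ξ' s)‖ ^ 2 := by
      rw [← intervalIntegral.integral_const_mul]
      exact intervalIntegral.integral_mono_on hab hi' (hAξ'.const_mul _) fun s _ => hsq _
    have hx'' : ∫ s in a..b, ‖ξ'' s‖ ^ 2
        ≤ 2 * ((∫ s in a..b, ‖ξ'' s + A (ξ' s)‖ ^ 2) + ∫ s in a..b, ‖A (ξ' s)‖ ^ 2) := by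
      rw [← intervalIntegral.integral_add hf' hAξ', ← intervalIntegral.integral_const_mul]
      refine intervalIntegral.integral_mono_on hab hi'' ((hf'.add hAξ').const_mul _)
        fun s _ => ?_
      have := hpar (ξ'' s + A (ξ' s)) (-A (ξ' s))
      rwa [add_neg_cancel_right, norm_neg] at this
    have hAf : ∫ s in a..b, ‖A (ξ' s) + A (A2 (ξ s))‖ ^ 2
        ≤ ‖A‖ ^ 2 * ∫ s in a..b, ‖ξ' s + A2 (ξ s)‖ ^ 2 := by
      rw [← intervalIntegral.integral_const_mul]
      refine intervalIntegral.integral_mono_on hab hfi (hf.const_mul _) fun s _ => ?_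
      rw [← map_add]
      exact hAsq _
    have hcube : ∀ (x : H2) i, |μ i| * ⟪i10 (A2 x), e i⟫ ^ 2
        = |μ i| ^ 3 * ⟪i10 (i21 x), e i⟫ ^ 2 := fun x i => by
      rw [hA2, hdiag, mul_pow, ← sq_abs (μ i)]
      ring
    simp only [hcube] at hE
    have nonneg_integral : ∀ {E : Type _} [NormedAddCommGroup E] (f : ℝ → E),
        0 ≤ ∫ s in a..b, ‖f s‖ ^ 2 := fun f =>
      intervalIntegral.integral_nonneg hab fun s _ => sq_nonneg _
    have h1 := nonneg_integral fun s => A (A2 (ξ s))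
    have h2 := nonneg_integral fun s => A (ξ' s)
    have h3 := intervalIntegral.integral_nonneg (μ := volume) hab
      fun s _ => sq_nonneg ‖ξ' s + A2 (ξ s)‖
    have h4 := nonneg_integral fun s => ξ'' s + A (ξ' s)
    have h5 := hbdry 3 (i10 (i21 (ξ a))) fun i => 0 < μ i
    have h6 := hbdry 3 (i10 (i21 (ξ b))) fun i => μ i < 0
    refine sqrt_le_mul_add_sqrt (by positivity) (add_nonneg h3 h4) h5 h6 ?_
    generalize (∑' i, if 0 < μ i then |μ i| ^ 3 * ⟪i10 (i21 (ξ a)), e i⟫ ^ 2 else 0) = Sa at *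
    generalize (∑' i, if μ i < 0 then |μ i| ^ 3 * ⟪i10 (i21 (ξ b)), e i⟫ ^ 2 else 0) = Sb at *
    generalize (∫ s in a..b, ‖ξ' s + A2 (ξ s)‖ ^ 2) = F at *
    generalize (∫ s in a..b, ‖ξ'' s + A (ξ' s)‖ ^ 2) = F' at *
    generalize (∫ s in a..b, ‖A (A2 (ξ s))‖ ^ 2) = P at *
    generalize (∫ s in a..b, ‖A (ξ' s)‖ ^ 2) = Q at *
    have hPQ : P + Q ≤ (‖A‖ ^ 2 + 1) * (F + F' + Sa + Sb) := by
      nlinarith [mul_nonneg (sq_nonneg ‖A‖) (add_nonneg (add_nonneg h4 h5) h6)]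
    have hM : (K2 ^ 2 * K ^ 2 + K ^ 2 + 2) * (P + Q)
        ≤ (K2 ^ 2 * K ^ 2 + K ^ 2 + 2) * ((‖A‖ ^ 2 + 1) * (F + F' + Sa + Sb)) :=
      mul_le_mul_of_nonneg_left hPQ (by positivity)
    have h7 : 0 ≤ K2 ^ 2 * K ^ 2 * Q := by positivity
    have h8 : 0 ≤ K ^ 2 * P := by positivity
    linarith
end
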